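/- arXiv:2308.15889 — 2 statements merged into one kernel-verified Lean document; each statement's English description precedes it below -/
import Mathlib

section
/- Let P be an extended logic program and 𝔅 a conflict group cover of P with chosen representatives. If L is any set of λ-extensions such that for every conflict group Γ ∈ 𝔅 some member of L belongs to Λ(Γ) (i.e., is a conflict-resolving λ-extension for the representative of Γ that resolves all conflicts of Γ), then the set {G(𝔅, lb) : lb ∈ L appearing as a label of some edge of G(𝔅)} is a clique cover of G(𝔅) of cardinality at most |L|; consequently every minimal clique cover Q of G(𝔅) satisfies |Q| ≤ |L|, so the label set of a minimal clique cover is a minimum-cardinality set of λ-extensions sufficient to resolve all conflicts of P. -/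
/-- A literal over atoms `α`: a positive atom or a strongly negated atom. -/
inductive Lit (α : Type*) where
  | pos : α → Lit α
  | neg : α → Lit α

/-- The strongly complementary literal. -/
def Lit.compl {α : Type*} : Lit α → Lit α
  | Lit.pos a => Lit.neg a
  | Lit.neg a => Lit.pos a

/-- The atom of a literal. -/
def Lit.atom {α : Type*} : Lit α → α
  | Lit.pos a => a
  | Lit.neg a => a

/-- A body element: a literal or a default-negated literal. -/
inductive BodyElem (α : Type*) where
  | lit : Lit α → BodyElem α
  | naf : Lit α → BodyElem α

/-- The atom of a body element. -/
def BodyElem.atom {α : Type*} : BodyElem α → α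
  | BodyElem.lit l => l.atom
  | BodyElem.naf l => l.atom

/-- A rule: a head literal together with a body of body elements. -/
structure Rule (α : Type*) where
  head : Lit α
  body : Set (BodyElem α)

/-- `B⁺(r)`: the literals occurring positively in the body of `r`. -/
def Rule.bpos {α : Type*} (r : Rule α) : Set (Lit α) := {l | BodyElem.lit l ∈ r.body}

/-- `B⁻(r)`: the literals occurring default-negated in the body of `r`. -/
def Rule.bneg {α : Type*} (r : Rule α) : Set (Lit α) := {l | BodyElem.naf l ∈ r.body}

/-- The atoms occurring in a rule (head and body). -/
def Rule.atoms {α : Type*} (r : Rule α) : Set α :=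
  insert r.head.atom (BodyElem.atom '' r.body)

/-- A set `S` of literals satisfies the body of `r` iff `B⁺(r) ⊆ S` and `B⁻(r) ∩ S = ∅`. -/
def SatisfiesBody {α : Type*} (S : Set (Lit α)) (r : Rule α) : Prop :=
  r.bpos ⊆ S ∧ ∀ l ∈ r.bneg, l ∉ S

/-- Two rules are conflicting iff their heads are strongly complementary and some set of
literals satisfies both bodies simultaneously. -/
def Conflicting {α : Type*} (r r' : Rule α) : Prop :=
  r.head = r'.head.compl ∧ ∃ S : Set (Lit α), SatisfiesBody S r ∧ SatisfiesBody S r'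

/-- A conflict of a program `P`: a two-element set of conflicting rules of `P`. -/
def IsConflict {α : Type*} (P : Set (Rule α)) (γ : Set (Rule α)) : Prop :=
  ∃ r r', r ∈ P ∧ r' ∈ P ∧ r ≠ r' ∧ Conflicting r r' ∧ γ = {r, r'}

/-- The λ-extended rule of `r` w.r.t. `X`: same head, body extended by `X`. -/
def extendRule {α : Type*} (r : Rule α) (X : Set (BodyElem α)) : Rule α :=
  { head := r.head, body := r.body ∪ X }

/-- `X` is built from atoms occurring in rules of `R`. -/
def AtomsFrom {α : Type*} (X : Set (BodyElem α)) (R : Set (Rule α)) : Prop :=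
  ∀ e ∈ X, ∃ s ∈ R, e.atom ∈ s.atoms

/-- `X` is a conflict-resolving λ-extension for `r` w.r.t. `R`. -/
def IsLambdaExtension {α : Type*} (r : Rule α) (R : Set (Rule α)) (X : Set (BodyElem α)) : Prop :=
  AtomsFrom X R ∧ ∀ r' ∈ R, ¬ Conflicting (extendRule r X) r'

/-- The conflict group `gr(r)` of a rule `r` in `P`: all conflicts of `P` containing `r`. -/
def ConflictGroup {α : Type*} (P : Set (Rule α)) (r : Rule α) : Set (Set (Rule α)) :=
  {γ | IsConflict P γ ∧ r ∈ γ}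

/-- `Γ` is a conflict group of `P`. -/
def IsConflictGroup {α : Type*} (P : Set (Rule α)) (Γ : Set (Set (Rule α))) : Prop :=
  ∃ r : Rule α, Γ = ConflictGroup P r

/-- The rules other than the representative occurring in the conflicts of `Γ`. -/
def OtherRules {α : Type*} (Γ : Set (Set (Rule α))) (rep : Rule α) : Set (Rule α) :=
  {s | ∃ γ ∈ Γ, s ∈ γ ∧ s ≠ rep}

/-- `X` is a λ-extension for the representative `rep` of `Γ` that resolves all conflicts
of `Γ`: `rep` belongs to every conflict of `Γ` and the λ-extended rule of `rep` w.r.t. `X`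
is not conflicting with any other rule occurring in the conflicts of `Γ`. -/
def Resolves {α : Type*} (Γ : Set (Set (Rule α))) (rep : Rule α) (X : Set (BodyElem α)) : Prop :=
  (∀ γ ∈ Γ, rep ∈ γ) ∧ IsLambdaExtension rep (OtherRules Γ rep) X

/-- `B` (with chosen representatives `rep`) is a conflict group cover of `P`:
every member is a resolvable conflict group of `P` (resolvable via its chosen
representative), and every conflict of `P` belongs to some member of `B`. -/
def IsGroupCover {α : Type*} (P : Set (Rule α)) (B : Set (Set (Set (Rule α))))
    (rep : Set (Set (Rule α)) → Rule α) : Prop :=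
  (∀ Γ ∈ B, IsConflictGroup P Γ ∧ ∃ X, Resolves Γ (rep Γ) X) ∧
  (∀ γ, IsConflict P γ → ∃ Γ ∈ B, γ ∈ Γ)

/-- Labeled edges of the λ-graph `G(B)`: a labeled edge between distinct conflict groups
sharing the λ-extension `lb`, and a self-loop when `lb` resolves only one group. -/
def GraphEdge {α : Type*} (B : Set (Set (Set (Rule α))))
    (rep : Set (Set (Rule α)) → Rule α)
    (Γ Γ' : Set (Set (Rule α))) (lb : Set (BodyElem α)) : Prop :=
  Γ ∈ B ∧ Γ' ∈ B ∧
    ((Γ ≠ Γ' ∧ Resolves Γ (rep Γ) lb ∧ Resolves Γ' (rep Γ') lb) ∨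
     (Γ = Γ' ∧ Resolves Γ (rep Γ) lb ∧ ∀ Δ ∈ B, Δ ≠ Γ → ¬ Resolves Δ (rep Δ) lb))

/-- The node set of the λ-clique `G(B, lb)`: all nodes incident to an edge labeled `lb`. -/
def CliqueNodes {α : Type*} (B : Set (Set (Set (Rule α))))
    (rep : Set (Set (Rule α)) → Rule α) (lb : Set (BodyElem α)) :
    Set (Set (Set (Rule α))) :=
  {Γ | ∃ Γ', GraphEdge B rep Γ Γ' lb ∨ GraphEdge B rep Γ' Γ lb}

/-- A clique cover of `G(B)`: a set of labels of (nonempty) λ-cliques such that every node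
of `G(B)` appears in at least one of the cliques. (A λ-clique is uniquely determined by
its label.) -/
def IsCliqueCover {α : Type*} (B : Set (Set (Set (Rule α))))
    (rep : Set (Set (Rule α)) → Rule α) (Q : Set (Set (BodyElem α))) : Prop :=
  (∀ lb ∈ Q, (CliqueNodes B rep lb).Nonempty) ∧
  ∀ Γ ∈ B, ∃ lb ∈ Q, Γ ∈ CliqueNodes B rep lb

theorem mem_cliqueNodes_iff {α : Type*} {B : Set (Set (Set (Rule α)))}
    {rep : Set (Set (Rule α)) → Rule α} {lb : Set (BodyElem α)} {Γ : Set (Set (Rule α))} :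
    Γ ∈ CliqueNodes B rep lb ↔ Γ ∈ B ∧ Resolves Γ (rep Γ) lb := by
  constructor
  · rintro ⟨Γ', ⟨h, h', ⟨-, hr, -⟩ | ⟨-, hr, -⟩⟩ | ⟨h', h, ⟨-, -, hr⟩ | ⟨rfl, hr, -⟩⟩⟩ <;>
      exact ⟨h, hr⟩
  · rintro ⟨h, hr⟩
    by_cases hΔ : ∃ Δ ∈ B, Δ ≠ Γ ∧ Resolves Δ (rep Δ) lb
    · obtain ⟨Δ, hB, hne, hΔr⟩ := hΔ
      exact ⟨Δ, Or.inl ⟨h, hB, Or.inl ⟨hne.symm, hr, hΔr⟩⟩⟩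
    · push Not at hΔ
      exact ⟨Γ, Or.inl ⟨h, h, Or.inr ⟨rfl, hr, hΔ⟩⟩⟩

/-- **Proposition 2 (minimality).** If `L` is any set of λ-extensions such that every
conflict group of the cover `B` is resolved (via its representative) by some member of
`L`, then the λ-cliques of `G(B)` labeled by members of `L` that actually appear as edge
labels form a clique cover of `G(B)` of cardinality at most `|L|`; consequently every
minimal clique cover `Q` of `G(B)` satisfies `|Q| ≤ |L|`, and its label set resolves all
conflict groups of `B`. -/
theorem minimal_cliqueCover_card_le {α : Type*}
    (P : Set (Rule α)) (B : Set (Set (Set (Rule α))))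
    (rep : Set (Set (Rule α)) → Rule α)
    (hcov : IsGroupCover P B rep)
    (L : Set (Set (BodyElem α)))
    (hL : ∀ Γ ∈ B, ∃ lb ∈ L, Resolves Γ (rep Γ) lb) :
    IsCliqueCover B rep {lb ∈ L | (CliqueNodes B rep lb).Nonempty} ∧
    Cardinal.mk {lb ∈ L | (CliqueNodes B rep lb).Nonempty} ≤ Cardinal.mk L ∧
    ∀ Q : Set (Set (BodyElem α)),
      IsCliqueCover B rep Q →
      (∀ Q' : Set (Set (BodyElem α)), IsCliqueCover B rep Q' →
        ¬ Cardinal.mk Q' < Cardinal.mk Q) →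
      Cardinal.mk Q ≤ Cardinal.mk L ∧ ∀ Γ ∈ B, ∃ lb ∈ Q, Resolves Γ (rep Γ) lb := by
  have hcover : IsCliqueCover B rep {lb ∈ L | (CliqueNodes B rep lb).Nonempty} := by
    refine ⟨fun lb hlb => hlb.2, fun Γ hΓ => ?_⟩
    obtain ⟨lb, hlb, hr⟩ := hL Γ hΓ
    have hmem : Γ ∈ CliqueNodes B rep lb := mem_cliqueNodes_iff.2 ⟨hΓ, hr⟩
    exact ⟨lb, ⟨hlb, Γ, hmem⟩, hmem⟩
  have hcard : Cardinal.mk {lb ∈ L | (CliqueNodes B rep lb).Nonempty} ≤ Cardinal.mk L :=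
    Cardinal.mk_le_mk_of_subset (Set.sep_subset _ _)
  refine ⟨hcover, hcard, fun Q hQ hmin => ⟨(not_lt.1 (hmin _ hcover)).trans hcard, ?_⟩⟩
  intro Γ hΓ
  obtain ⟨lb, hlb, hmem⟩ := hQ.2 Γ hΓ
  exact ⟨lb, hlb, (mem_cliqueNodes_iff.1 hmem).2⟩
end

section
/- Let P be an extended logic program, r ∈ P, X a set of body elements, and r'' the rule with head(r'') = head(r) and body(r'') = body(r) ∪ X. Let P' = (P \ {r}) ∪ {r''}. Then every conflict of P' either is a conflict of P that does not contain r, or is of the form {r'', s} for some rule s ∈ P \ {r} such that {r, s} is a conflict of P. -/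
theorem Lit.compl_compl {α : Type*} (l : Lit α) : l.compl.compl = l := by
  cases l <;> rfl

theorem Conflicting.symm {α : Type*} {r s : Rule α} (h : Conflicting r s) : Conflicting s r := by
  obtain ⟨hh, S, hr, hs⟩ := h
  exact ⟨by rw [hh, Lit.compl_compl], S, hs, hr⟩

theorem SatisfiesBody.of_extendRule {α : Type*} {S : Set (Lit α)} {r : Rule α}
    {X : Set (BodyElem α)} (h : SatisfiesBody S (extendRule r X)) : SatisfiesBody S r :=
  ⟨fun _ hl => h.1 (Or.inl hl), fun l hl => h.2 l (Or.inl hl)⟩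

theorem Conflicting.of_extendRule {α : Type*} {r s : Rule α} {X : Set (BodyElem α)}
    (h : Conflicting (extendRule r X) s) : Conflicting r s := by
  obtain ⟨hh, S, hr, hs⟩ := h
  exact ⟨hh, S, hr.of_extendRule, hs⟩

/-- Replacing a rule `r ∈ P` by a body-extended version `r''` can only remove, never
create, conflicts: every conflict of `P' = (P \ {r}) ∪ {r''}` is either a conflict of `P`
not containing `r`, or of the form `{r'', s}` for some `s ∈ P \ {r}` such that `{r, s}`
is a conflict of `P`. -/
theorem conflicts_after_replacement {α : Type*}
    (P : Set (Rule α)) (r : Rule α) (hr : r ∈ P) (X : Set (BodyElem α)) :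
    ∀ γ : Set (Rule α),
      IsConflict ((P \ {r}) ∪ {extendRule r X}) γ →
        (IsConflict P γ ∧ r ∉ γ) ∨
        (∃ s ∈ P \ {r}, γ = {extendRule r X, s} ∧ IsConflict P {r, s}) := by
  rintro γ ⟨a, b, ha | rfl, hb | rfl, hab, hc, rfl⟩
  · refine Or.inl ⟨⟨a, b, ha.1, hb.1, hab, hc, rfl⟩, ?_⟩
    rintro (h | h)
    · exact ha.2 h.symm
    · exact hb.2 h.symm
  · exact Or.inr ⟨a, ha, Set.pair_comm _ _,
      r, a, hr, ha.1, fun h => ha.2 h.symm, hc.symm.of_extendRule, rfl⟩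
  · exact Or.inr ⟨b, hb, rfl, r, b, hr, hb.1, fun h => hb.2 h.symm, hc.of_extendRule, rfl⟩
  · exact absurd rfl hab
end
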